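/- arXiv:1902.10299 — 4 statements merged into one kernel-verified Lean document; each statement's English description precedes it below -/
import Mathlib

section
/- Let a, b, c, d be real constants and consider the complex-coefficient quadratic polynomial g(s) = s² + (a + b·i)s + (c + d·i), where i is the imaginary unit. Then every root of g(s) = 0 has negative real part if and only if a > 0 and a·b·d + a²·c − d² > 0. -/
open Complex

/-- Routh–Hurwitz-type stability criterion for a degree-two polynomial with complex
coefficients: every root of `g(s) = s² + (a + b·i)s + (c + d·i)` lies in the open left
half-plane if and only if `a > 0` and `a·b·d + a²·c − d² > 0`. -/
theorem stmt_0 (a b c d : ℝ) :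
    (∀ s : ℂ, s ^ 2 + ((a : ℂ) + (b : ℂ) * Complex.I) * s + ((c : ℂ) + (d : ℂ) * Complex.I) = 0 →
      s.re < 0) ↔ (0 < a ∧ 0 < a * b * d + a ^ 2 * c - d ^ 2) := by
  obtain ⟨w, hw⟩ := IsAlgClosed.exists_pow_nat_eq
    (((a : ℂ) + (b : ℂ) * Complex.I) ^ 2 - 4 * ((c : ℂ) + (d : ℂ) * Complex.I)) (n := 2) (by norm_num)
  obtain ⟨x, hx⟩ : ∃ x : ℂ, x = (-((a : ℂ) + (b : ℂ) * Complex.I) + w) / 2 := ⟨_, rfl⟩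
  obtain ⟨y, hy⟩ : ∃ y : ℂ, y = (-((a : ℂ) + (b : ℂ) * Complex.I) - w) / 2 := ⟨_, rfl⟩
  have hB : (a : ℂ) + (b : ℂ) * Complex.I = -(x + y) := by rw [hx, hy]; ring
  have hC : (c : ℂ) + (d : ℂ) * Complex.I = x * y := by
    rw [hx, hy]; linear_combination (1 / 4 : ℂ) * hw
  rw [hB, hC]
  have ha : a = -(x.re + y.re) := by simpa using congrArg Complex.re hB
  have hb : b = -(x.im + y.im) := by simpa using congrArg Complex.im hB
  have hc : c = x.re * y.re - x.im * y.im := by simpa using congrArg Complex.re hC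
  have hd : d = x.re * y.im + x.im * y.re := by simpa using congrArg Complex.im hC
  have hE : a * b * d + a ^ 2 * c - d ^ 2 =
      x.re * y.re * ((x.re + y.re) ^ 2 + (x.im - y.im) ^ 2) := by
    rw [ha, hb, hc, hd]; ring
  rw [hE, ha]
  constructor
  · intro h
    have h1 := h x (by ring)
    have h2 := h y (by ring)
    have h3 : 0 < x.re * y.re := mul_pos_of_neg_of_neg h1 h2
    have h4 : 0 < (x.re + y.re) ^ 2 := by apply sq_pos_of_neg; linarith
    exact ⟨by linarith, mul_pos h3 (by positivity)⟩
  · rintro ⟨h1, h2⟩ s hs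
    have h3 : 0 < x.re * y.re := pos_of_mul_pos_left h2 (by positivity)
    have h4 : (s - x) * (s - y) = 0 := by linear_combination hs
    rcases mul_eq_zero.mp h4 with h | h
    · rw [sub_eq_zero.mp h]
      rcases mul_pos_iff.mp h3 with h | h <;> linarith
    · rw [sub_eq_zero.mp h]
      rcases mul_pos_iff.mp h3 with h | h <;> linarith
end

section
/- Let n ≥ 2 and let L be a real n×n matrix such that L_{ij} = −a_{ij} ≤ 0 for all i ≠ j and L_{ii} = Σ_{j≠i} a_{ij}, where a_{ij} ≥ 0, and suppose the associated directed graph (with an edge from j to i whenever a_{ij} > 0) is strongly connected, i.e., for any two distinct indices i, j there is a finite sequence i = k₀, k₁, …, k_m = j with a_{k_t k_{t+1}} > 0 for each t. Then the all-ones vector 1_n satisfies L·1_n = 0, the eigenvalue 0 of L has algebraic multiplicity 1, and every nonzero complex eigenvalue of L has strictly positive real part. -/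
theorem lap_apply {n : ℕ} (a : Fin n → Fin n → ℝ)
    (L : Matrix (Fin n) (Fin n) ℝ)
    (hoff : ∀ i j, i ≠ j → L i j = -a i j)
    (hdiag : ∀ i, L i i = ∑ j ∈ Finset.univ.erase i, a i j) (w : Fin n → ℝ) (i : Fin n) :
    L.mulVec w i = ∑ j, a i j * (w i - w j) := by
  rw [Matrix.mulVec, dotProduct, ← Finset.add_sum_erase _ _ (Finset.mem_univ i),
    ← Finset.add_sum_erase Finset.univ (fun j => a i j * (w i - w j)) (Finset.mem_univ i), hdiag,
    Finset.sum_mul, ← Finset.sum_add_distrib]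
  simp only [sub_self, mul_zero, zero_add]
  refine Finset.sum_congr rfl fun j hj => ?_
  rw [hoff i j (Finset.ne_of_mem_erase hj).symm]
  ring

theorem lap_const {n : ℕ} (hn : 2 ≤ n) (a : Fin n → Fin n → ℝ)
    (ha : ∀ i j, 0 ≤ a i j)
    (L : Matrix (Fin n) (Fin n) ℝ)
    (hoff : ∀ i j, i ≠ j → L i j = -a i j)
    (hdiag : ∀ i, L i i = ∑ j ∈ Finset.univ.erase i, a i j)
    (hconn : ∀ i j : Fin n, i ≠ j → ∃ m : ℕ, ∃ k : ℕ → Fin n,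
      k 0 = i ∧ k m = j ∧ ∀ t < m, 0 < a (k t) (k (t + 1)))
    (w : Fin n → ℝ) (c : ℝ) (hw : ∀ i, L.mulVec w i = c) : c = 0 ∧ ∃ b, ∀ i, w i = b := by
  have : Nonempty (Fin n) := ⟨⟨0, by omega⟩⟩
  obtain ⟨p, hp⟩ := Finite.exists_max w
  obtain ⟨q, hq⟩ := Finite.exists_min w
  have h1 : 0 ≤ c := by
    rw [← hw p, lap_apply a L hoff hdiag]
    exact Finset.sum_nonneg fun j _ => mul_nonneg (ha _ _) (sub_nonneg.2 (hp j))
  have h2 : c ≤ 0 := by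
    rw [← hw q, lap_apply a L hoff hdiag]
    exact Finset.sum_nonpos fun j _ =>
      mul_nonpos_of_nonneg_of_nonpos (ha _ _) (sub_nonpos.2 (hq j))
  have hc : c = 0 := le_antisymm h2 h1
  refine ⟨hc, w p, fun i => ?_⟩
  by_cases hpi : p = i
  · rw [hpi]
  obtain ⟨m, k, hk0, hkm, hk⟩ := hconn p i hpi
  have key : ∀ t, t ≤ m → w (k t) = w p := by
    intro t
    induction t with
    | zero => intro _; rw [hk0]
    | succ t ih =>
      intro ht
      have e := ih (by omega)
      have hs := hw (k t)
      rw [lap_apply a L hoff hdiag, hc, Finset.sum_eq_zero_iff_of_nonneg] at hs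
      · have := hs (k (t+1)) (Finset.mem_univ _)
        have hpos := hk t (by omega)
        rcases mul_eq_zero.1 this with h | h
        · exact absurd h hpos.ne'
        · linarith
      · intro j _
        exact mul_nonneg (ha _ _) (sub_nonneg.2 (e ▸ hp j))
  rw [← hkm]; exact key m le_rfl

/-- For the Laplacian matrix `L` of a strongly connected weighted directed graph on `n ≥ 2`
nodes, the all-ones vector is a right null vector of `L`, the eigenvalue `0` has algebraic
multiplicity `1`, and every nonzero complex eigenvalue of `L` has strictly positive
real part. -/
theorem stmt_10 (n : ℕ) (hn : 2 ≤ n) (a : Fin n → Fin n → ℝ)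
    (ha : ∀ i j, 0 ≤ a i j)
    (L : Matrix (Fin n) (Fin n) ℝ)
    (hoff : ∀ i j, i ≠ j → L i j = -a i j)
    (hdiag : ∀ i, L i i = ∑ j ∈ Finset.univ.erase i, a i j)
    (hconn : ∀ i j : Fin n, i ≠ j → ∃ m : ℕ, ∃ k : ℕ → Fin n,
      k 0 = i ∧ k m = j ∧ ∀ t < m, 0 < a (k t) (k (t + 1))) :
    L.mulVec (fun _ => 1) = 0 ∧
    (Matrix.charpoly L).rootMultiplicity 0 = 1 ∧
    ∀ μ : ℂ, μ ≠ 0 → (Matrix.charpoly (L.map Complex.ofReal)).IsRoot μ → 0 < μ.re := by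
  have hone : L.mulVec (fun _ => 1) = 0 := by
    ext i
    rw [lap_apply a L hoff hdiag]
    simp
  have hC := lap_const hn a ha L hoff hdiag hconn
  refine ⟨hone, ?_, ?_⟩
  · have hpow : ∀ (k : ℕ) (v : Fin n → ℝ), ((Matrix.toLin' L) ^ k) v = 0 →
        ∃ b, ∀ i, v i = b := by
      intro k
      induction k with
      | zero => intro v hv; exact ⟨0, fun i => by simpa using congrFun hv i⟩
      | succ k ih =>
        intro v hv
        rw [pow_succ, Module.End.mul_apply] at hv
        obtain ⟨b, hb⟩ := ih _ hv
        exact (hC v b (fun i => by simpa using hb i)).2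
    have hspan : Module.End.maxGenEigenspace (Matrix.toLin' L) 0 =
        Submodule.span ℝ {(fun _ => 1 : Fin n → ℝ)} := by
      ext v
      rw [Module.End.mem_maxGenEigenspace, Submodule.mem_span_singleton]
      constructor
      · rintro ⟨k, hk⟩
        obtain ⟨b, hb⟩ := hpow k v (by simpa using hk)
        exact ⟨b, by ext i; simp [hb]⟩
      · rintro ⟨b, rfl⟩
        refine ⟨1, ?_⟩
        simp [hone]
    have h := LinearMap.finrank_maxGenEigenspace_eq (Matrix.toLin' L) 0
    rw [hspan, finrank_span_singleton, Matrix.charpoly_toLin'] at h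
    · exact h.symm
    · intro h0
      simpa using congrFun h0 ⟨0, by omega⟩
  · intro μ hμ hroot
    rw [← Matrix.charpoly_toLin', ← Module.End.hasEigenvalue_iff_isRoot_charpoly] at hroot
    obtain ⟨k, hk⟩ := eigenvalue_mem_ball hroot
    have hd : ∑ j ∈ Finset.univ.erase k, ‖(L.map Complex.ofReal) k j‖ = L k k := by
      rw [hdiag]
      refine Finset.sum_congr rfl fun j hj => ?_
      rw [Matrix.map_apply, hoff k j (Finset.ne_of_mem_erase hj).symm]
      simp [abs_of_nonneg (ha k j)]
    have hL : 0 ≤ L k k := by rw [hdiag]; exact Finset.sum_nonneg fun j _ => ha _ _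
    rw [hd, mem_closedBall_iff_norm, Matrix.map_apply] at hk
    have h2 : ‖μ - (L k k : ℂ)‖ ^ 2 ≤ L k k ^ 2 := by gcongr
    rw [Complex.sq_norm, Complex.normSq_apply] at h2
    simp at h2
    by_contra hneg
    push Not at hneg
    have h3 : μ.re * L k k ≤ 0 := mul_nonpos_of_nonpos_of_nonneg hneg hL
    have hr : μ.re = 0 := by nlinarith [sq_nonneg μ.re, sq_nonneg μ.im]
    have hi : μ.im = 0 := by nlinarith [sq_nonneg μ.re, sq_nonneg μ.im]
    exact hμ (Complex.ext hr hi)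
end

section
/- Let n ≥ 2 and let L be a real n×n matrix such that L_{ij} = −a_{ij} ≤ 0 for all i ≠ j and L_{ii} = Σ_{j≠i} a_{ij}, where a_{ij} ≥ 0, and suppose the associated directed graph (with an edge from j to i whenever a_{ij} > 0) is strongly connected, i.e., for any two distinct indices i, j there is a finite sequence i = k₀, k₁, …, k_m = j with a_{k_t k_{t+1}} > 0 for each t. Then there exists a vector ξ ∈ ℝⁿ with ξᵀL = 0 and ξ_i > 0 for all i = 1, …, n, and the left null space of L is one-dimensional, i.e., any vector η with ηᵀL = 0 is a scalar multiple of ξ. -/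
/-- For the Laplacian matrix `L` of a strongly connected weighted directed graph on `n ≥ 2`
nodes, there is a left null vector `ξ` of `L` with all entries strictly positive, and the
left null space of `L` is one-dimensional: every left null vector is a scalar multiple
of `ξ`. -/
theorem stmt_11 (n : ℕ) (hn : 2 ≤ n) (a : Fin n → Fin n → ℝ)
    (ha : ∀ i j, 0 ≤ a i j)
    (L : Matrix (Fin n) (Fin n) ℝ)
    (hoff : ∀ i j, i ≠ j → L i j = -a i j)
    (hdiag : ∀ i, L i i = ∑ j ∈ Finset.univ.erase i, a i j)
    (hconn : ∀ i j : Fin n, i ≠ j → ∃ m : ℕ, ∃ k : ℕ → Fin n,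
      k 0 = i ∧ k m = j ∧ ∀ t < m, 0 < a (k t) (k (t + 1))) :
    ∃ ξ : Fin n → ℝ, Matrix.vecMul ξ L = 0 ∧ (∀ i, 0 < ξ i) ∧
      ∀ η : Fin n → ℝ, Matrix.vecMul η L = 0 → ∃ c : ℝ, η = c • ξ := by
  have hrow : ∀ i, ∑ j, L i j = 0 := by
    intro i
    rw [← Finset.add_sum_erase _ _ (Finset.mem_univ i), hdiag, ← Finset.sum_add_distrib]
    apply Finset.sum_eq_zero
    intro j hj
    rw [hoff i j (Finset.ne_of_mem_erase hj).symm]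
    ring
  have hnp : ∀ i j, i ≠ j → L i j ≤ 0 := by
    intro i j h
    rw [hoff i j h]
    linarith [ha i j]
  have hvm : ∀ (v : Fin n → ℝ), Matrix.vecMul v L = 0 → ∀ j, ∑ i, v i * L i j = 0 := by
    intro v hv j
    exact congrFun hv j
  have habs : ∀ (v : Fin n → ℝ), Matrix.vecMul v L = 0 → ∀ j, ∑ i, |v i| * L i j = 0 := by
    intro v hv
    have hle : ∀ j ∈ Finset.univ, ∑ i, |v i| * L i j ≤ 0 := by
      intro j _
      have h0 := hvm v hv j
      rcases le_total 0 (v j) with h | h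
      · rw [← h0]
        apply Finset.sum_le_sum
        intro i _
        by_cases hij : i = j
        · subst hij
          rw [abs_of_nonneg h]
        · exact mul_le_mul_of_nonpos_right (le_abs_self _) (hnp i j hij)
      · have h1 : ∑ i, (-v i) * L i j = 0 := by
          simp only [neg_mul, Finset.sum_neg_distrib, h0, neg_zero]
        rw [← h1]
        apply Finset.sum_le_sum
        intro i _
        by_cases hij : i = j
        · subst hij
          rw [abs_of_nonpos h]
        · exact mul_le_mul_of_nonpos_right (neg_le_abs _) (hnp i j hij)
    have hsum : ∑ j, ∑ i, |v i| * L i j = 0 := by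
      rw [Finset.sum_comm]
      apply Finset.sum_eq_zero
      intro i _
      rw [← Finset.mul_sum, hrow, mul_zero]
    intro j
    exact (Finset.sum_eq_zero_iff_of_nonpos hle).1 hsum j (Finset.mem_univ j)
  have hstep : ∀ (v : Fin n → ℝ), Matrix.vecMul v L = 0 → ∀ i j, v j = 0 → 0 < a i j →
      v i = 0 := by
    intro v hv i j hj hij
    by_cases e : i = j
    · rw [e, hj]
    have h := habs v hv j
    have hle : ∀ i ∈ Finset.univ, |v i| * L i j ≤ 0 := by
      intro i _
      by_cases e : i = j
      · rw [e, hj]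
        simp
      · exact mul_nonpos_of_nonneg_of_nonpos (abs_nonneg _) (hnp i j e)
    have h2 := (Finset.sum_eq_zero_iff_of_nonpos hle).1 h i (Finset.mem_univ i)
    rcases mul_eq_zero.1 h2 with h3 | h3
    · exact abs_eq_zero.1 h3
    · rw [hoff i j e] at h3
      linarith
  have hzero : ∀ (v : Fin n → ℝ), Matrix.vecMul v L = 0 → ∀ j, v j = 0 → v = 0 := by
    intro v hv j hj
    funext i
    by_cases e : i = j
    · rw [e, hj]
      rfl
    obtain ⟨m, k, hk0, hkm, hk⟩ := hconn i j e
    have key : ∀ t, t ≤ m → v (k (m - t)) = 0 := by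
      intro t
      induction t with
      | zero =>
        intro _
        rw [Nat.sub_zero, hkm, hj]
      | succ t ih =>
        intro ht
        have h1 := hk (m - (t + 1)) (by omega)
        have h2 : m - (t + 1) + 1 = m - t := by omega
        rw [h2] at h1
        exact hstep v hv _ _ (ih (by omega)) h1
    have := key m le_rfl
    rw [Nat.sub_self, hk0] at this
    exact this
  let z : Fin n := ⟨0, by omega⟩
  have hdet : L.det = 0 := by
    apply Matrix.exists_mulVec_eq_zero_iff.1
    refine ⟨fun _ => 1, fun h => one_ne_zero (congrFun h z), ?_⟩
    funext i
    simpa [Matrix.mulVec, dotProduct] using hrow i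
  obtain ⟨v, hv0, hv⟩ := Matrix.exists_vecMul_eq_zero_iff.2 hdet
  have hpos : ∀ i, 0 < |v i| := fun i => abs_pos.2 fun h => hv0 (hzero v hv i h)
  have hξ : Matrix.vecMul (fun i => |v i|) L = 0 := funext fun j => habs v hv j
  refine ⟨fun i => |v i|, hξ, hpos, ?_⟩
  intro η hη
  refine ⟨η z / |v z|, ?_⟩
  apply sub_eq_zero.1
  apply hzero _ _ z
  · have := (hpos z).ne'
    simp only [Pi.sub_apply, Pi.smul_apply, smul_eq_mul]
    rw [div_mul_cancel₀ _ this, sub_self]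
  · rw [Matrix.sub_vecMul, Matrix.smul_vecMul, hη, hξ, smul_zero, sub_zero]
end

section
/- Let X be a complex normed vector space, let T : X → X be a linear map with ‖T x‖ ≤ q‖x‖ for all x ∈ X for some q ∈ (0, 1), and let (x_k)_{k≥0} satisfy x_{k+1} = T x_k + c_k with ‖c_k‖ ≤ c for some c > 0. Let ε > 0 and suppose x₀ ≠ 0. Then for every integer k ≥ log(ε·c/((1 − q)·‖x₀‖))/log(q), one has ‖x_k‖ ≤ (1 + ε)·c/(1 − q). -/
/-- Finite-time entry into the target neighborhood for the perturbed contraction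
`x_{k+1} = T x_k + c_k`: for every integer `k ≥ log(ε·c/((1 − q)·‖x₀‖))/log(q)` one has
`‖x_k‖ ≤ (1 + ε)·c/(1 − q)`. -/
theorem stmt_15 {X : Type*} [NormedAddCommGroup X] [NormedSpace ℂ X]
    (T : X →ₗ[ℂ] X) (q c ε : ℝ) (hq0 : 0 < q) (hq1 : q < 1) (hc : 0 < c) (hε : 0 < ε)
    (hT : ∀ x : X, ‖T x‖ ≤ q * ‖x‖)
    (x cs : ℕ → X)
    (hrec : ∀ k : ℕ, x (k + 1) = T (x k) + cs k)
    (hcs : ∀ k : ℕ, ‖cs k‖ ≤ c)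
    (hx0 : x 0 ≠ 0) :
    ∀ k : ℕ, Real.log (ε * c / ((1 - q) * ‖x 0‖)) / Real.log q ≤ (k : ℝ) →
      ‖x k‖ ≤ (1 + ε) * c / (1 - q) := by
  intro k hk
  have h1q : 0 < 1 - q := by linarith
  have hn : 0 < ‖x 0‖ := norm_pos_iff.mpr hx0
  have key : ∀ n : ℕ, ‖x n‖ ≤ q ^ n * ‖x 0‖ + c / (1 - q) := by
    intro n
    induction n with
    | zero =>
      have : 0 < c / (1 - q) := by positivity
      simp only [pow_zero, one_mul]
      linarith
    | succ n ih =>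
      have h1 : ‖x (n + 1)‖ ≤ ‖T (x n)‖ + ‖cs n‖ := by
        rw [hrec]
        exact norm_add_le _ _
      have h2 := hT (x n)
      have h3 := hcs n
      have h4 := mul_le_mul_of_nonneg_left ih hq0.le
      have h5 : q * (q ^ n * ‖x 0‖ + c / (1 - q)) + c
          = q ^ (n + 1) * ‖x 0‖ + c / (1 - q) := by
        field_simp
        ring
      linarith
  have hlog : Real.log q < 0 := Real.log_neg hq0 hq1
  rw [div_le_iff_of_neg hlog, ← Real.log_pow,
    Real.log_le_log_iff (by positivity) (by positivity), le_div_iff₀ (by positivity)] at hk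
  have h6 : q ^ k * ‖x 0‖ ≤ ε * c / (1 - q) := by
    rw [le_div_iff₀ h1q]
    linarith
  have h7 : (1 + ε) * c / (1 - q) = ε * c / (1 - q) + c / (1 - q) := by ring
  rw [h7]
  linarith [key k]
end
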